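/- Let C ≥ 2 and d be positive natural numbers, J > 0 a real number, y_i ≠ y_j two distinct classes in Fin C, and x_i, x_j ∈ ℝ^d. Let h⁰ and h¹ map each point of ℝ^d to a probability vector on Fin C and suppose: (i) |h⁰_{y_i}(x_i) − h⁰_{y_i}(x_j)| ≤ 1/J and |h¹_{y_j}(x_i) − h¹_{y_j}(x_j)| ≤ 1/J; (ii) h⁰_{y_i}(x_i) ≥ 1/2 + 1/J and h¹_{y_j}(x_j) ≥ 1/2 + 1/J; (iii) h⁰_{y_i}(x_j) ≤ 1/2 + 1/J and h¹_{y_j}(x_i) ≤ 1/2 + 1/J; (iv) h⁰_c(x_i) ≤ (1 − h⁰_{y_i}(x_i))/(C − 1) for every c ≠ y_i, and h⁰_c(x_j) ≤ (1 − h⁰_{y_i}(x_j))/(C − 1) for every c with c ≠ y_i and c ≠ y_j; (v) h¹_c(x_j) ≤ (1 − h¹_{y_j}(x_j))/(C − 1) for every c ≠ y_j, and h¹_c(x_i) ≤ (1 − h¹_{y_j}(x_i))/(C − 1) for every c with c ≠ y_i and c ≠ y_j. Then the average ensemble g = (h⁰ + h¹)/2 satisfies g_c(x_i) ≤ g_{y_i}(x_i)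 for every c ≠ y_i and g_c(x_j) ≤ g_{y_j}(x_j) for every c ≠ y_j; consequently the empirical 0-1 loss of g on the dataset {(x_i, y_i), (x_j, y_j)} equals 0. -/

import Mathlib

open Finset

/-- `maxOther hC f y` is `max_{c ≠ y} f c`, the largest predicted score among the
classes different from `y` (well-defined since `C ≥ 2`). -/
noncomputable def maxOther {C : ℕ} (hC : 2 ≤ C) (f : Fin C → ℝ) (y : Fin C) : ℝ :=
  (Finset.univ.filter (fun c => c ≠ y)).sup'
    (by
      obtain ⟨c, hc⟩ := Fintype.exists_ne_of_one_lt_card (by rw [Fintype.card_fin]; exact hC) y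
      exact ⟨c, by simp [hc]⟩) f

/-- If every class other than `s` and `t` has score at most the equal share
`(1 - q t) / (C - 1)` of the mass off `t`, then `s` has at least that share. -/
lemma equal_share_le_of_others_le {C : ℕ} (hC : 2 ≤ C) {q : Fin C → ℝ} (hq : ∑ c, q c = 1)
    {s t : Fin C} (hst : s ≠ t)
    (hother : ∀ c, c ≠ s → c ≠ t → q c ≤ (1 - q t) / ((C : ℝ) - 1)) :
    (1 - q t) / ((C : ℝ) - 1) ≤ q s := by
  have hC' : (2 : ℝ) ≤ C := by exact_mod_cast hC
  have hs : s ∈ univ.erase t := by simp [hst]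
  have hcard : (((univ.erase t).erase s).card : ℝ) = (C : ℝ) - 2 := by
    rw [card_erase_of_mem hs, card_erase_of_mem (mem_univ t), card_univ, Fintype.card_fin,
      Nat.sub_sub, Nat.cast_sub hC]
    norm_num
  have hle : ∑ c ∈ (univ.erase t).erase s, q c ≤ ((C : ℝ) - 2) * ((1 - q t) / ((C : ℝ) - 1)) := by
    rw [← hcard, ← nsmul_eq_mul]
    refine sum_le_card_nsmul _ _ _ fun c hc => ?_
    simp only [mem_erase, mem_univ, and_true] at hc
    exact hother c hc.1 hc.2
  have hsplit : q t + (q s + ∑ c ∈ (univ.erase t).erase s, q c) = 1 := by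
    rw [add_sum_erase _ q hs, add_sum_erase _ q (mem_univ t), hq]
  have hshare : (1 - q t) / ((C : ℝ) - 1) * ((C : ℝ) - 1) = 1 - q t :=
    div_mul_cancel₀ _ (by linarith)
  linarith

/-- If `p` puts mass at least `1 / 2` on `s`, `q` puts no more mass on `t` than `p` does on `s`,
and the remaining scores are at most equal shares, then `s` maximizes `p + q`. -/
lemma add_le_add_of_confident {C : ℕ} (hC : 2 ≤ C) {p q : Fin C → ℝ} (hq : ∑ c, q c = 1)
    {s t : Fin C} (hst : s ≠ t) (hhalf : 1 / 2 ≤ p s) (hqp : q t ≤ p s)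
    (hp : ∀ c, c ≠ s → p c ≤ (1 - p s) / ((C : ℝ) - 1))
    (hother : ∀ c, c ≠ s → c ≠ t → q c ≤ (1 - q t) / ((C : ℝ) - 1))
    {c : Fin C} (hc : c ≠ s) : p c + q c ≤ p s + q s := by
  have hC' : (2 : ℝ) ≤ C := by exact_mod_cast hC
  have hpos : (0 : ℝ) < (C : ℝ) - 1 := by linarith
  have hqs := equal_share_le_of_others_le hC hq hst hother
  have hpc := hp c hc
  by_cases hct : c = t
  · subst hct
    have hshare : (1 - p s) / ((C : ℝ) - 1) ≤ (1 - q c) / ((C : ℝ) - 1) := by gcongr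
    linarith
  · have hqc := hother c hc hct
    have hshare : (1 - p s) / ((C : ℝ) - 1) ≤ p s := by
      rw [div_le_iff₀ hpos]
      nlinarith
    linarith

lemma maxOther_le {C : ℕ} (hC : 2 ≤ C) {f : Fin C → ℝ} {y : Fin C}
    (h : ∀ c, c ≠ y → f c ≤ f y) : maxOther hC f y ≤ f y :=
  sup'_le _ _ fun c hc => h c (by simpa using hc)

/-- Full Case III of the ensemble analysis in Theorem 5.1 for the average combiner:
each base classifier confidently classifies one example of an ambiguous pair and mildly
misclassifies the other, with small scores on the remaining classes; the average
ensemble then classifies both examples correctly, yielding empirical 0-1 loss `0` on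
the pair. -/
theorem average_ensemble_zero_loss_on_ambiguous_pair
    (d C : ℕ) (hd : 0 < d) (hC : 2 ≤ C) (J : ℝ) (hJ : 0 < J)
    (yi yj : Fin C) (hy : yi ≠ yj)
    (xi xj : EuclideanSpace ℝ (Fin d))
    (h0 h1 : EuclideanSpace ℝ (Fin d) → Fin C → ℝ)
    (h0pos : ∀ x c, 0 ≤ h0 x c) (h0sum : ∀ x, ∑ c, h0 x c = 1)
    (h1pos : ∀ x c, 0 ≤ h1 x c) (h1sum : ∀ x, ∑ c, h1 x c = 1)
    (hi0 : |h0 xi yi - h0 xj yi| ≤ 1 / J) (hi1 : |h1 xi yj - h1 xj yj| ≤ 1 / J)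
    (hii0 : h0 xi yi ≥ 1 / 2 + 1 / J) (hii1 : h1 xj yj ≥ 1 / 2 + 1 / J)
    (hiii0 : h0 xj yi ≤ 1 / 2 + 1 / J) (hiii1 : h1 xi yj ≤ 1 / 2 + 1 / J)
    (hiv : ∀ c, c ≠ yi → h0 xi c ≤ (1 - h0 xi yi) / ((C : ℝ) - 1))
    (hiv' : ∀ c, c ≠ yi → c ≠ yj → h0 xj c ≤ (1 - h0 xj yi) / ((C : ℝ) - 1))
    (hv : ∀ c, c ≠ yj → h1 xj c ≤ (1 - h1 xj yj) / ((C : ℝ) - 1))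
    (hv' : ∀ c, c ≠ yi → c ≠ yj → h1 xi c ≤ (1 - h1 xi yj) / ((C : ℝ) - 1)) :
    ∀ g : EuclideanSpace ℝ (Fin d) → Fin C → ℝ,
      (∀ x c, g x c = (h0 x c + h1 x c) / 2) →
      (∀ c, c ≠ yi → g xi c ≤ g xi yi) ∧
      (∀ c, c ≠ yj → g xj c ≤ g xj yj) ∧
      ((if g xi yi < maxOther hC (g xi) yi then (1 : ℝ) else 0) +
        (if g xj yj < maxOther hC (g xj) yj then (1 : ℝ) else 0)) / 2 = 0 := by
  intro g hg
  have hJ' : 0 < 1 / J := by positivity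
  have hxi : ∀ c, c ≠ yi → g xi c ≤ g xi yi := fun c hc => by
    have := add_le_add_of_confident hC (h1sum xi) hy (by linarith) (by linarith) hiv hv' hc
    rw [hg, hg]
    linarith
  have hxj : ∀ c, c ≠ yj → g xj c ≤ g xj yj := fun c hc => by
    have := add_le_add_of_confident hC (h0sum xj) hy.symm (by linarith) (by linarith) hv
      (fun c hj hi => hiv' c hi hj) hc
    rw [hg, hg]
    linarith
  refine ⟨hxi, hxj, ?_⟩
  rw [if_neg (maxOther_le hC hxi).not_gt, if_neg (maxOther_le hC hxj).not_gt]
  norm_num
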